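/- arXiv:1806.05005 — 3 statements merged into one kernel-verified Lean document; each statement's English description precedes it below -/
import Mathlib

section
/- The lower-bound program attains its minimum on its (nonempty, compact, convex) feasible set [0,S]^{N·2^N·|C|}, and any two minimizers μ̃ and μ̃' induce the same load vectors, i.e., for every B ⊆ {1,…,N} with P_d(B) > 0, every g ∈ C with P_c(g) > 0, and every n, one has 1[n∈B]·(S − μ̄_n) + μ̃_n(B,g) = 1[n∈B]·(S − μ̄'_n) + μ̃'_n(B,g). -/
open Finset

/-- Feasible points of the lower-bound program: `μ̃_n(B,g) ∈ [0,S]` for every user `n`,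
requesting set `B ⊆ {1,…,N}` and channel vector `g ∈ C` (encoded by the finite type `G`). -/
def FeasibleLB {N : ℕ} {G : Type} (S : ℝ)
    (μ : Fin N → Finset (Fin N) → G → ℝ) : Prop :=
  ∀ n B γ, 0 ≤ μ n B γ ∧ μ n B γ ≤ S

/-- `μ̄_n = ∑_{h∈C} ∑_{D⊆N} P_c(h) P_d(D) μ̃_n(D,h)`. -/
noncomputable def muBar {N : ℕ} {G : Type} [Fintype G]
    (Pd : Finset (Fin N) → ℝ) (Pc : G → ℝ)
    (μ : Fin N → Finset (Fin N) → G → ℝ) (n : Fin N) : ℝ :=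
  ∑ γ : G, ∑ D : Finset (Fin N), Pc γ * Pd D * μ n D γ

/-- The objective of the lower-bound program:
`∑_{g∈C} ∑_{B⊆N} P_c(g) P_d(B) C_d([1[n∈B](S−μ̄_n) + μ̃_n(B,g)]_n; g)`. -/
noncomputable def lbObj {N : ℕ} {G : Type} [Fintype G]
    (Pd : Finset (Fin N) → ℝ) (Pc : G → ℝ)
    (Cd : (Fin N → ℝ) → G → ℝ) (S : ℝ)
    (μ : Fin N → Finset (Fin N) → G → ℝ) : ℝ :=
  ∑ γ : G, ∑ B : Finset (Fin N),
    Pc γ * Pd B *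
      Cd (fun n => (if n ∈ B then (1 : ℝ) else 0) * (S - muBar Pd Pc μ n) + μ n B γ) γ

section

variable {N : ℕ} {G : Type}

theorem isCompact_feasibleLB (S : ℝ) :
    IsCompact {μ : Fin N → Finset (Fin N) → G → ℝ | FeasibleLB S μ} := by
  have h : {μ : Fin N → Finset (Fin N) → G → ℝ | FeasibleLB S μ} =
      Set.univ.pi fun _ => Set.univ.pi fun _ => Set.univ.pi fun _ => Set.Icc 0 S := by
    ext μ
    simp only [FeasibleLB, Set.mem_ofPred_eq,
      Set.mem_pi, Set.mem_univ, true_implies, Set.mem_Icc]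
  rw [h]
  exact isCompact_univ_pi fun _ => isCompact_univ_pi fun _ => isCompact_univ_pi fun _ =>
    isCompact_Icc

theorem FeasibleLB.midpoint {S : ℝ} {μ μ' : Fin N → Finset (Fin N) → G → ℝ}
    (h : FeasibleLB S μ) (h' : FeasibleLB S μ') :
    FeasibleLB S (fun n B γ => (1 / 2 : ℝ) * μ n B γ + (1 / 2 : ℝ) * μ' n B γ) := by
  intro n B γ
  have := h n B γ
  have := h' n B γ
  constructor <;> dsimp only <;> linarith

variable [Fintype G]

theorem muBar_midpoint (Pd : Finset (Fin N) → ℝ) (Pc : G → ℝ)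
    (μ μ' : Fin N → Finset (Fin N) → G → ℝ) (n : Fin N) :
    muBar Pd Pc (fun n B γ => (1 / 2 : ℝ) * μ n B γ + (1 / 2 : ℝ) * μ' n B γ) n =
      (1 / 2 : ℝ) * muBar Pd Pc μ n + (1 / 2 : ℝ) * muBar Pd Pc μ' n := by
  simp only [muBar, Finset.mul_sum, ← Finset.sum_add_distrib]
  refine Finset.sum_congr rfl fun γ _ => Finset.sum_congr rfl fun D _ => ?_
  ring

theorem muBar_le {Pd : Finset (Fin N) → ℝ} (hPd : ∀ B, 0 ≤ Pd B)
    (hPd1 : ∑ B : Finset (Fin N), Pd B = 1)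
    {Pc : G → ℝ} (hPc : ∀ γ, 0 ≤ Pc γ) (hPc1 : ∑ γ : G, Pc γ = 1)
    {S : ℝ} {μ : Fin N → Finset (Fin N) → G → ℝ} (h : FeasibleLB S μ) (n : Fin N) :
    muBar Pd Pc μ n ≤ S := by
  calc muBar Pd Pc μ n ≤ ∑ γ : G, ∑ D : Finset (Fin N), Pc γ * Pd D * S :=
        Finset.sum_le_sum fun γ _ => Finset.sum_le_sum fun D _ =>
          mul_le_mul_of_nonneg_left (h n D γ).2 (mul_nonneg (hPc γ) (hPd D))
    _ = S := by
        simp only [← Finset.sum_mul, ← Finset.mul_sum, hPd1, hPc1, mul_one, one_mul]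

/-- The load placed on user `n` in state `(B, γ)` by the policy `μ`. -/
noncomputable def lbLoad (Pd : Finset (Fin N) → ℝ) (Pc : G → ℝ) (S : ℝ)
    (μ : Fin N → Finset (Fin N) → G → ℝ) (B : Finset (Fin N)) (γ : G) (n : Fin N) : ℝ :=
  (if n ∈ B then (1 : ℝ) else 0) * (S - muBar Pd Pc μ n) + μ n B γ

theorem lbObj_eq_sum_lbLoad (Pd : Finset (Fin N) → ℝ) (Pc : G → ℝ)
    (Cd : (Fin N → ℝ) → G → ℝ) (S : ℝ) (μ : Fin N → Finset (Fin N) → G → ℝ) :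
    lbObj Pd Pc Cd S μ = ∑ γ : G, ∑ B : Finset (Fin N),
      Pc γ * Pd B * Cd (lbLoad Pd Pc S μ B γ) γ := rfl

theorem lbLoad_nonneg {Pd : Finset (Fin N) → ℝ} (hPd : ∀ B, 0 ≤ Pd B)
    (hPd1 : ∑ B : Finset (Fin N), Pd B = 1)
    {Pc : G → ℝ} (hPc : ∀ γ, 0 ≤ Pc γ) (hPc1 : ∑ γ : G, Pc γ = 1)
    {S : ℝ} {μ : Fin N → Finset (Fin N) → G → ℝ} (h : FeasibleLB S μ)
    (B : Finset (Fin N)) (γ : G) (n : Fin N) : 0 ≤ lbLoad Pd Pc S μ B γ n :=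
  add_nonneg (mul_nonneg (by split_ifs <;> norm_num)
    (sub_nonneg.2 (muBar_le hPd hPd1 hPc hPc1 h n))) (h n B γ).1

theorem lbLoad_midpoint (Pd : Finset (Fin N) → ℝ) (Pc : G → ℝ) (S : ℝ)
    (μ μ' : Fin N → Finset (Fin N) → G → ℝ) (B : Finset (Fin N)) (γ : G) :
    lbLoad Pd Pc S (fun n B γ => (1 / 2 : ℝ) * μ n B γ + (1 / 2 : ℝ) * μ' n B γ) B γ =
      (1 / 2 : ℝ) • lbLoad Pd Pc S μ B γ + (1 / 2 : ℝ) • lbLoad Pd Pc S μ' B γ := by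
  ext n
  simp only [lbLoad, muBar_midpoint, Pi.add_apply, Pi.smul_apply, smul_eq_mul]
  ring

theorem continuous_lbObj (Pd : Finset (Fin N) → ℝ) (Pc : G → ℝ)
    {Cd : (Fin N → ℝ) → G → ℝ} (hCont : ∀ γ, Continuous fun L => Cd L γ) (S : ℝ) :
    Continuous (lbObj Pd Pc Cd S) := by
  unfold lbObj
  refine continuous_finsetSum _ fun γ _ => continuous_finsetSum _ fun B _ =>
    continuous_const.mul ((hCont γ).comp (continuous_pi fun n => ?_))
  unfold muBar
  fun_prop

/-- If two feasible policies induce different loads in some state of positive probability,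
their midpoint costs strictly less than the average of their costs. -/
theorem lbObj_midpoint_lt {Pd : Finset (Fin N) → ℝ} (hPd : ∀ B, 0 ≤ Pd B)
    (hPd1 : ∑ B : Finset (Fin N), Pd B = 1)
    {Pc : G → ℝ} (hPc : ∀ γ, 0 ≤ Pc γ) (hPc1 : ∑ γ : G, Pc γ = 1)
    {Cd : (Fin N → ℝ) → G → ℝ}
    (hConv : ∀ γ, StrictConvexOn ℝ {L : Fin N → ℝ | ∀ n, 0 ≤ L n} (fun L => Cd L γ))
    {S : ℝ} {μ μ' : Fin N → Finset (Fin N) → G → ℝ}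
    (h : FeasibleLB S μ) (h' : FeasibleLB S μ')
    {B : Finset (Fin N)} {γ : G} (hB : 0 < Pd B) (hγ : 0 < Pc γ)
    (hne : lbLoad Pd Pc S μ B γ ≠ lbLoad Pd Pc S μ' B γ) :
    lbObj Pd Pc Cd S (fun n B γ => (1 / 2 : ℝ) * μ n B γ + (1 / 2 : ℝ) * μ' n B γ) <
      (1 / 2 : ℝ) * lbObj Pd Pc Cd S μ + (1 / 2 : ℝ) * lbObj Pd Pc Cd S μ' := by
  simp only [lbObj_eq_sum_lbLoad, lbLoad_midpoint, Finset.mul_sum, ← Finset.sum_add_distrib]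
  have hL := lbLoad_nonneg hPd hPd1 hPc hPc1 h
  have hL' := lbLoad_nonneg hPd hPd1 hPc hPc1 h'
  have hle : ∀ γ B, Pc γ * Pd B *
      Cd ((1 / 2 : ℝ) • lbLoad Pd Pc S μ B γ + (1 / 2 : ℝ) • lbLoad Pd Pc S μ' B γ) γ ≤
      (1 / 2 : ℝ) * (Pc γ * Pd B * Cd (lbLoad Pd Pc S μ B γ) γ) +
        (1 / 2 : ℝ) * (Pc γ * Pd B * Cd (lbLoad Pd Pc S μ' B γ) γ) := by
    intro γ B
    have := mul_le_mul_of_nonneg_left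
      ((hConv γ).convexOn.2 (hL B γ) (hL' B γ)
        (one_half_pos (α := ℝ)).le one_half_pos.le (add_halves 1)) (mul_nonneg (hPc γ) (hPd B))
    simp only [smul_eq_mul] at this
    linarith
  refine Finset.sum_lt_sum (fun γ _ => Finset.sum_le_sum fun B _ => hle γ B)
    ⟨γ, Finset.mem_univ _, Finset.sum_lt_sum (fun B _ => hle γ B) ⟨B, Finset.mem_univ _, ?_⟩⟩
  have := mul_lt_mul_of_pos_left
    ((hConv γ).2 (hL B γ) (hL' B γ) hne (one_half_pos (α := ℝ)) one_half_pos (add_halves 1)) (mul_pos hγ hB)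
  simp only [smul_eq_mul] at this
  linarith

end

/-- **Existence of a minimizer and uniqueness of the optimal loads.**
The lower-bound program attains its minimum on the compact convex feasible set, and any
two minimizers induce the same load vectors on every pair `(B, g)` of positive
probability. -/
theorem lb_program_min_attained_and_loads_unique
    {N : ℕ} (hN : 1 ≤ N) {G : Type} [Fintype G] [Nonempty G]
    (gval : G → Fin N → ℝ) (hgval : ∀ γ n, 0 < gval γ n)
    (Pd : Finset (Fin N) → ℝ) (hPd : ∀ B, 0 ≤ Pd B)
    (hPd1 : ∑ B : Finset (Fin N), Pd B = 1)
    (Pc : G → ℝ) (hPc : ∀ γ, 0 ≤ Pc γ) (hPc1 : ∑ γ : G, Pc γ = 1)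
    (S : ℝ) (hS : 0 < S)
    (Cd : (Fin N → ℝ) → G → ℝ)
    (hCont : ∀ γ, Continuous (fun L => Cd L γ))
    (hConv : ∀ γ, StrictConvexOn ℝ {L : Fin N → ℝ | ∀ n, 0 ≤ L n} (fun L => Cd L γ))
    (hMono : ∀ γ (L L' : Fin N → ℝ), (∀ n, L n ≤ L' n) → Cd L γ ≤ Cd L' γ)
    (hNonneg : ∀ γ (L : Fin N → ℝ), (∀ n, 0 ≤ L n) → 0 ≤ Cd L γ) :
    (∃ μ : Fin N → Finset (Fin N) → G → ℝ, FeasibleLB S μ ∧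
        ∀ μ' : Fin N → Finset (Fin N) → G → ℝ, FeasibleLB S μ' →
          lbObj Pd Pc Cd S μ ≤ lbObj Pd Pc Cd S μ')
    ∧ (∀ μ μ' : Fin N → Finset (Fin N) → G → ℝ,
        FeasibleLB S μ → FeasibleLB S μ' →
        (∀ ν, FeasibleLB S ν → lbObj Pd Pc Cd S μ ≤ lbObj Pd Pc Cd S ν) →
        (∀ ν, FeasibleLB S ν → lbObj Pd Pc Cd S μ' ≤ lbObj Pd Pc Cd S ν) →
        ∀ (B : Finset (Fin N)) (γ : G) (n : Fin N), 0 < Pd B → 0 < Pc γ →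
          (if n ∈ B then (1 : ℝ) else 0) * (S - muBar Pd Pc μ n) + μ n B γ
            = (if n ∈ B then (1 : ℝ) else 0) * (S - muBar Pd Pc μ' n) + μ' n B γ) := by
  refine ⟨?_, fun μ μ' h h' hmin hmin' B γ n hB hγ => ?_⟩
  · obtain ⟨μ, hμ, hmin⟩ := (isCompact_feasibleLB S).exists_isMinOn
      ⟨fun _ _ _ => 0, fun _ _ _ => ⟨le_rfl, hS.le⟩⟩ (continuous_lbObj Pd Pc hCont S).continuousOn
    exact ⟨μ, hμ, fun μ' hμ' => hmin hμ'⟩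
  · by_contra hn
    have hlt := lbObj_midpoint_lt hPd hPd1 hPc hPc1 hConv h h' hB hγ
      fun heq => hn (congrFun heq n)
    linarith [hmin _ (h.midpoint h'), hmin' _ (h.midpoint h')]
end

section
/- Let C : ℝ^N → ℝ be convex, continuous, and nondecreasing in each coordinate, and let (x_l)_{l≥0} be a bounded sequence in ℝ^N. Then limsup_{t→∞} (1/t) ∑_{l=0}^{t−1} C(x_l) ≥ C(v), where v ∈ ℝ^N is the vector with coordinates v_n = liminf_{t→∞} (1/t) ∑_{l=0}^{t−1} (x_l)_n. -/
open Filter Finset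

theorem average_range_le_of_forall_le {u : ℕ → ℝ} {M : ℝ} (hu : ∀ l, u l ≤ M) {t : ℕ}
    (ht : 0 < t) : (1 / (t : ℝ)) * ∑ l ∈ Finset.range t, u l ≤ M := by
  have ht' : (0 : ℝ) < t := by exact_mod_cast ht
  have h : ∑ l ∈ Finset.range t, u l ≤ t * M := by
    simpa using Finset.sum_le_card_nsmul (Finset.range t) u M fun l _ => hu l
  rw [one_div, inv_mul_le_iff₀ ht']
  exact h

theorem le_average_range_of_forall_le {u : ℕ → ℝ} {M : ℝ} (hu : ∀ l, M ≤ u l) {t : ℕ}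
    (ht : 0 < t) : M ≤ (1 / (t : ℝ)) * ∑ l ∈ Finset.range t, u l := by
  have h := average_range_le_of_forall_le (u := fun l => -u l) (fun l => neg_le_neg (hu l)) ht
  simpa using h

theorem ConvexOn.map_average_range_le {ι : Type*} {C : (ι → ℝ) → ℝ}
    (hC : ConvexOn ℝ Set.univ C) (x : ℕ → ι → ℝ) {t : ℕ} (ht : 0 < t) :
    C (fun n => (1 / (t : ℝ)) * ∑ l ∈ Finset.range t, x l n)
      ≤ (1 / (t : ℝ)) * ∑ l ∈ Finset.range t, C (x l) := by
  have ht' : (t : ℝ) ≠ 0 := by exact_mod_cast ht.ne'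
  have h := hC.map_sum_le (t := Finset.range t) (w := fun _ => 1 / (t : ℝ)) (p := x)
    (fun _ _ => by positivity) (by simp [ht']) (fun _ _ => Set.mem_univ _)
  rw [← Finset.smul_sum, ← Finset.smul_sum] at h
  have hx : (fun n => (1 / (t : ℝ)) * ∑ l ∈ Finset.range t, x l n)
      = (1 / (t : ℝ)) • ∑ l ∈ Finset.range t, x l := by
    ext n
    simp
  rw [hx]
  exact h

/-- **Cesàro–Jensen–monotonicity inequality.**
If `C : ℝ^N → ℝ` is convex, continuous, and nondecreasing in each coordinate, and
`(x_l)` is a bounded sequence in `ℝ^N`, then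
`limsup_t (1/t) ∑_{l<t} C (x_l) ≥ C v`, where `v_n = liminf_t (1/t) ∑_{l<t} (x_l)_n`. -/
theorem cesaro_jensen_monotone
    {N : ℕ} (C : (Fin N → ℝ) → ℝ)
    (hConv : ConvexOn ℝ Set.univ C)
    (hCont : Continuous C)
    (hMono : ∀ x y : Fin N → ℝ, (∀ n, x n ≤ y n) → C x ≤ C y)
    (x : ℕ → Fin N → ℝ)
    (hBdd : ∃ M : ℝ, ∀ l n, |x l n| ≤ M) :
    C (fun n => liminf (fun t : ℕ => (1 / (t : ℝ)) * ∑ l ∈ Finset.range t, x l n) atTop)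
      ≤ limsup (fun t : ℕ => (1 / (t : ℝ)) * ∑ l ∈ Finset.range t, C (x l)) atTop := by
  obtain ⟨M, hM⟩ := hBdd
  refine le_limsup_of_le ?_ fun b hb => ?_
  · refine isBoundedUnder_of_eventually_le (a := C fun _ => M) ?_
    filter_upwards [eventually_gt_atTop 0] with t ht
    exact average_range_le_of_forall_le
      (fun l => hMono _ _ fun n => (abs_le.mp (hM l n)).2) ht
  set v : Fin N → ℝ := fun n =>
    liminf (fun t : ℕ => (1 / (t : ℝ)) * ∑ l ∈ Finset.range t, x l n) atTop
  have hlower : ∀ ε > 0, C (fun n => v n - ε) ≤ b := by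
    intro ε hε
    have hev : ∀ᶠ t : ℕ in atTop, ∀ n,
        v n - ε < (1 / (t : ℝ)) * ∑ l ∈ Finset.range t, x l n := by
      refine eventually_all.mpr fun n => eventually_lt_of_lt_liminf (sub_lt_self _ hε) ?_
      refine isBoundedUnder_of_eventually_ge (a := -M) ?_
      filter_upwards [eventually_gt_atTop 0] with t ht
      exact le_average_range_of_forall_le (fun l => (abs_le.mp (hM l n)).1) ht
    obtain ⟨t, hlt, hle, ht⟩ := (hev.and (hb.and (eventually_gt_atTop 0))).exists
    exact (hMono _ _ fun n => (hlt n).le).trans ((hConv.map_average_range_le x ht).trans hle)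
  have hcont : Continuous fun ε : ℝ => C (fun n => v n - ε) := by fun_prop
  have hlim : Tendsto (fun ε : ℝ => C (fun n => v n - ε)) (nhdsWithin 0 (Set.Ioi 0))
      (nhds (C v)) := by
    simpa using (hcont.tendsto 0).mono_left nhdsWithin_le_nhds
  exact le_of_tendsto hlim (by filter_upwards [self_mem_nhdsWithin] with ε hε using hlower ε hε)
end

section
/- Consider a single user (N = 1) with certain demand (the user requests in every slot with probability 1) and two channel states 0 < g^(1) < g^(2) occurring i.i.d. with probabilities ψ ∈ (0,1) and 1−ψ respectively, and take the cost C_d(L ; g) = L^4 / g. Then the lower-bound program value is strictly smaller than the reactive cost: c̲_U = min_{0 ≤ μ̃(g^(1)), μ̃(g^(2)) ≤ S} [ ψ·((S − μ̄ + μ̃(g^(1)))^4 / g^(1)) + (1−ψ)·((S − μ̄ + μ̃(g^(2)))^4 / g^(2)) ] < ψ·S^4/g^(1) + (1−ψ)·S^4/g^(2) = c^R, where μ̄ = ψ·μ̃(g^(1)) + (1−ψ)·μ̃(g^(2)). Hence even with certain demand, channel variability yields a strict proactive gain. -/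
open Filter Finset

/-- Shifting a small load from the bad channel state to the good one while keeping the mean load
fixed strictly decreases the expected quartic cost. -/
lemma exists_shift_expected_cost_lt {S g1 g2 ψ : ℝ} (hS : 0 < S) (hg1 : 0 < g1) (hg12 : g1 < g2)
    (hψ0 : 0 < ψ) (hψ1 : ψ < 1) :
    ∃ ε : ℝ, 0 ≤ ε ∧ ε ≤ 1 ∧
      ψ * ((S * (1 - (1 - ψ) * ε)) ^ 4 / g1) + (1 - ψ) * ((S * (1 + ψ * ε)) ^ 4 / g2)
        < ψ * S ^ 4 / g1 + (1 - ψ) * S ^ 4 / g2 := by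
  have hg2 : 0 < g2 := hg1.trans hg12
  obtain ⟨ε, hε⟩ : ∃ ε, ε = (g2 - g1) / (6 * g2) := ⟨_, rfl⟩
  have hε0 : 0 < ε := hε ▸ div_pos (sub_pos.2 hg12) (by positivity)
  have hεg : 6 * g2 * ε = g2 - g1 := by rw [hε]; field_simp
  have hε1 : ε ≤ 1 := by rw [hε, div_le_one (by positivity)]; linarith
  have ha : 0 < 1 - ψ := sub_pos.2 hψ1
  refine ⟨ε, hε0.le, hε1, ?_⟩
  obtain ⟨x, hx⟩ : ∃ x, x = (1 - ψ) * ε := ⟨_, rfl⟩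
  obtain ⟨y, hy⟩ : ∃ y, y = ψ * ε := ⟨_, rfl⟩
  have hx0 : 0 < x := hx ▸ mul_pos ha hε0
  have hy0 : 0 < y := hy ▸ mul_pos hψ0 hε0
  have hxε : x ≤ ε := by rw [hx]; nlinarith
  have hyε : y ≤ ε := by rw [hy]; nlinarith
  have hlow : 4 - 6 * ε ≤ 4 - 6 * x + 4 * x ^ 2 - x ^ 3 := by
    nlinarith [mul_nonneg (sq_nonneg x) (show 0 ≤ 4 - x by linarith)]
  have hupp : 4 + 6 * y + 4 * y ^ 2 + y ^ 3 ≤ 4 + 11 * ε := by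
    have h2 : y ^ 2 ≤ y := by nlinarith
    have h3 : y ^ 3 ≤ y := by nlinarith
    linarith
  have hkey : g1 * (4 + 6 * y + 4 * y ^ 2 + y ^ 3) < g2 * (4 - 6 * x + 4 * x ^ 2 - x ^ 3) :=
    calc g1 * (4 + 6 * y + 4 * y ^ 2 + y ^ 3) ≤ g1 * (4 + 11 * ε) := by gcongr
      _ < g2 * (4 - 6 * ε) := by nlinarith [mul_lt_mul_of_pos_right hg12 hε0]
      _ ≤ g2 * (4 - 6 * x + 4 * x ^ 2 - x ^ 3) := by gcongr
  have hdiff : ψ * S ^ 4 / g1 + (1 - ψ) * S ^ 4 / g2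
      - (ψ * ((S * (1 - x)) ^ 4 / g1) + (1 - ψ) * ((S * (1 + y)) ^ 4 / g2))
      = ψ * (1 - ψ) * ε * S ^ 4 * (g2 * (4 - 6 * x + 4 * x ^ 2 - x ^ 3)
        - g1 * (4 + 6 * y + 4 * y ^ 2 + y ^ 3)) / (g1 * g2) := by
    rw [hx, hy]
    field_simp
    ring
  rw [← hx, ← hy, ← sub_pos, hdiff]
  have := sub_pos.2 hkey
  positivity

/-- **Strict proactive gain from channel variability.**
Single user, certain demand, two i.i.d. channel states `0 < g1 < g2` with
`P(g = g1) = ψ ∈ (0,1)`, cost `C_d(L; g) = L^4 / g`.  The optimal value `c̲_U` of the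
lower-bound program (minimization over `μ̃(g1), μ̃(g2) ∈ [0,S]` of the expected cost of
the induced loads, with `μ̄ = ψ μ̃(g1) + (1−ψ) μ̃(g2)`) is strictly smaller than the
reactive cost `c^R = ψ S^4/g1 + (1−ψ) S^4/g2`. -/
theorem channel_variability_strict_gain
    (S g1 g2 ψ : ℝ) (hS : 0 < S) (hg1 : 0 < g1) (hg12 : g1 < g2)
    (hψ0 : 0 < ψ) (hψ1 : ψ < 1) :
    sInf { c : ℝ | ∃ μ1 μ2 : ℝ, 0 ≤ μ1 ∧ μ1 ≤ S ∧ 0 ≤ μ2 ∧ μ2 ≤ S ∧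
        c = ψ * ((S - (ψ * μ1 + (1 - ψ) * μ2) + μ1) ^ 4 / g1)
          + (1 - ψ) * ((S - (ψ * μ1 + (1 - ψ) * μ2) + μ2) ^ 4 / g2) }
      < ψ * S ^ 4 / g1 + (1 - ψ) * S ^ 4 / g2 := by
  obtain ⟨ε, hε0, hε1, hlt⟩ := exists_shift_expected_cost_lt hS hg1 hg12 hψ0 hψ1
  have hg2 : 0 < g2 := hg1.trans hg12
  have ha : 0 < 1 - ψ := sub_pos.2 hψ1
  refine lt_of_le_of_lt (csInf_le ?_ ?_) hlt
  · refine ⟨0, ?_⟩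
    rintro c ⟨μ1, μ2, -, -, -, -, rfl⟩
    positivity
  · refine ⟨0, S * ε, le_rfl, hS.le, by positivity, mul_le_of_le_one_right hS.le hε1, ?_⟩
    ring
end
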